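/- arXiv:2310.18068 — 11 statements merged into one kernel-verified Lean document; each statement's English description precedes it below -/
import Mathlib

section
/- Let A and B be finite nonempty subsets of ℝ × ℝ separated by the vertical line x = m, and assume A ∪ B is in general position. Let (α₁, α₂) be an upper supporting pair of A and (β₁, β₂) an upper supporting pair of B, let l be the midpoint of the segment α₁α₂ and r the midpoint of the segment β₁β₂. If the slope of α₁α₂ is less than or equal to the slope of lr, then every supporting pair (a, b) of (A, B) satisfies a₁ ≤ (α₁)₁; that is, the left endpoint of the upper bridge precedes the edge α. (Bridge-search case 1.) -/
/-- `s` lies on or below the line through `p` and `q` (where `p.1 < q.1`). -/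
def OnOrBelow (p q s : ℝ × ℝ) : Prop :=
  (q.1 - p.1) * (s.2 - p.2) ≤ (s.1 - p.1) * (q.2 - p.2)

/-- `s` lies strictly below the line through `p` and `q`. -/
def StrictlyBelow (p q s : ℝ × ℝ) : Prop :=
  (q.1 - p.1) * (s.2 - p.2) < (s.1 - p.1) * (q.2 - p.2)

/-- `s` lies on or above the line through `p` and `q`. -/
def OnOrAbove (p q s : ℝ × ℝ) : Prop :=
  (q.1 - p.1) * (s.2 - p.2) ≥ (s.1 - p.1) * (q.2 - p.2)

/-- `s` lies on the line through `p` and `q`. -/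
def OnLine (p q s : ℝ × ℝ) : Prop :=
  (q.1 - p.1) * (s.2 - p.2) = (s.1 - p.1) * (q.2 - p.2)

/-- `(p, q)` is an upper supporting pair of the finite set `S`. -/
def UpperSupportingPair (S : Finset (ℝ × ℝ)) (p q : ℝ × ℝ) : Prop :=
  p ∈ S ∧ q ∈ S ∧ p.1 < q.1 ∧ ∀ s ∈ S, OnOrBelow p q s

/-- `A` and `B` are separated by the vertical line `x = m`. -/
def SeparatedBy (A B : Finset (ℝ × ℝ)) (m : ℝ) : Prop :=
  (∀ a ∈ A, a.1 < m) ∧ (∀ b ∈ B, m < b.1)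

/-- `(a, b) ∈ A × B` is a supporting pair of `(A, B)`. -/
def SupportingPair (A B : Finset (ℝ × ℝ)) (a b : ℝ × ℝ) : Prop :=
  a ∈ A ∧ b ∈ B ∧ ∀ s ∈ A ∪ B, OnOrBelow a b s

/-- A finite set is in general position if no three distinct points of it are collinear. -/
def GeneralPosition (S : Finset (ℝ × ℝ)) : Prop :=
  ∀ p ∈ S, ∀ q ∈ S, ∀ r ∈ S, p ≠ q → p ≠ r → q ≠ r →
    ¬ Collinear ℝ ({p, q, r} : Set (ℝ × ℝ))

/-- The slope of the segment from `p` to `q`. -/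
noncomputable def segSlope (p q : ℝ × ℝ) : ℝ := (q.2 - p.2) / (q.1 - p.1)

/-- The midpoint of the segment `pq`. -/
noncomputable def midpt (p q : ℝ × ℝ) : ℝ × ℝ := ((p.1 + q.1) / 2, (p.2 + q.2) / 2)

/-- `p` is an upper-hull vertex of `S`: some non-vertical line through `p`
has every other point of `S` strictly below it. -/
def UpperHullVertex (S : Finset (ℝ × ℝ)) (p : ℝ × ℝ) : Prop :=
  p ∈ S ∧ ∃ k : ℝ, ∀ s ∈ S, s ≠ p → s.2 < p.2 + k * (s.1 - p.1)

/-- `(p, q)` is an edge of the upper convex hull of `S`. -/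
def UpperHullEdge (S : Finset (ℝ × ℝ)) (p q : ℝ × ℝ) : Prop :=
  p ∈ S ∧ q ∈ S ∧ p.1 < q.1 ∧ ∀ s ∈ S, s ≠ p → s ≠ q → StrictlyBelow p q s

theorem onOrBelow_iff_le_segSlope {p q : ℝ × ℝ} (h : p.1 < q.1) (s : ℝ × ℝ) :
    OnOrBelow p q s ↔ s.2 ≤ p.2 + segSlope p q * (s.1 - p.1) := by
  have hd : 0 < q.1 - p.1 := sub_pos.2 h
  have hs : segSlope p q * (s.1 - p.1) = (s.1 - p.1) * (q.2 - p.2) / (q.1 - p.1) := by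
    unfold segSlope; ring
  rw [OnOrBelow, hs, ← sub_le_iff_le_add', le_div_iff₀ hd, mul_comm (q.1 - p.1)]

theorem snd_eq_add_segSlope {p q : ℝ × ℝ} (h : p.1 < q.1) :
    q.2 = p.2 + segSlope p q * (q.1 - p.1) := by
  rw [segSlope, div_mul_cancel₀ _ (sub_pos.2 h).ne']
  ring

theorem collinear_of_snd_eq {p q r : ℝ × ℝ} (k : ℝ) (hq : q.2 = p.2 + k * (q.1 - p.1))
    (hr : r.2 = p.2 + k * (r.1 - p.1)) : Collinear ℝ ({p, q, r} : Set (ℝ × ℝ)) := by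
  rw [collinear_iff_of_mem (p₀ := p) (by simp)]
  refine ⟨(1, k), ?_⟩
  rintro s (rfl | rfl | rfl)
  · exact ⟨0, by simp⟩
  · refine ⟨s.1 - p.1, Prod.ext (by simp) ?_⟩
    simp only [vadd_eq_add, Prod.snd_add, Prod.smul_snd, smul_eq_mul]
    linarith
  · refine ⟨s.1 - p.1, Prod.ext (by simp) ?_⟩
    simp only [vadd_eq_add, Prod.snd_add, Prod.smul_snd, smul_eq_mul]
    linarith

theorem bridge_case1
    (A B : Finset (ℝ × ℝ)) (m : ℝ) (hA : A.Nonempty) (hB : B.Nonempty)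
    (hsep : SeparatedBy A B m) (hgp : GeneralPosition (A ∪ B))
    (α₁ α₂ β₁ β₂ : ℝ × ℝ)
    (hα : UpperSupportingPair A α₁ α₂) (hβ : UpperSupportingPair B β₁ β₂)
    (hslope : segSlope α₁ α₂ ≤ segSlope (midpt α₁ α₂) (midpt β₁ β₂)) :
    ∀ a b : ℝ × ℝ, SupportingPair A B a b → a.1 ≤ α₁.1 := by
  rintro a b ⟨ha, hb, hab⟩
  obtain ⟨hα₁, hα₂, hα_lt, hα_le⟩ := hα
  obtain ⟨hβ₁, hβ₂, -, -⟩ := hβ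
  have hab_lt : a.1 < b.1 := (hsep.1 a ha).trans (hsep.2 b hb)
  have mα₁ := hsep.1 _ hα₁
  have mα₂ := hsep.1 _ hα₂
  have mβ₁ := hsep.2 _ hβ₁
  have mβ₂ := hsep.2 _ hβ₂
  have ma := hsep.1 _ ha
  have mb := hsep.2 _ hb
  have below_bridge : ∀ s ∈ A ∪ B, s.2 ≤ a.2 + segSlope a b * (s.1 - a.1) := fun s hs =>
    (onOrBelow_iff_le_segSlope hab_lt s).1 (hab s hs)
  have hα₁_le := below_bridge α₁ (Finset.mem_union_left _ hα₁)
  have hβ₁_le := below_bridge β₁ (Finset.mem_union_right _ hβ₁)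
  have hβ₂_le := below_bridge β₂ (Finset.mem_union_right _ hβ₂)
  have ha_le := (onOrBelow_iff_le_segSlope hα_lt a).1 (hα_le a ha)
  have hα₂_eq := snd_eq_add_segSlope hα_lt
  have hb_eq := snd_eq_add_segSlope hab_lt
  have hlr_lt : (midpt α₁ α₂).1 < (midpt β₁ β₂).1 := by
    simp only [midpt]; linarith
  have hlr_eq := snd_eq_add_segSlope hlr_lt
  have hlr_le := mul_le_mul_of_nonneg_right hslope (sub_pos.2 hlr_lt).le
  generalize segSlope (midpt α₁ α₂) (midpt β₁ β₂) = j at hlr_eq hlr_le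
  simp only [midpt] at hlr_eq hlr_le
  generalize segSlope α₁ α₂ = k at *
  generalize segSlope a b = K at *
  by_contra! hlt
  have hKk : K ≤ k := by
    by_contra! h
    nlinarith [mul_pos (sub_pos.2 h) (sub_pos.2 hlt)]
  have hkK : k ≤ K := by
    by_contra! h
    have hr : a.1 < (β₁.1 + β₂.1) / 2 := by linarith
    nlinarith [mul_pos (sub_pos.2 h) (sub_pos.2 hr)]
  obtain rfl : K = k := le_antisymm hKk hkK
  refine hgp α₁ (Finset.mem_union_left _ hα₁) α₂ (Finset.mem_union_left _ hα₂) b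
    (Finset.mem_union_right _ hb) ?_ ?_ ?_ (collinear_of_snd_eq K hα₂_eq (by linarith))
  · rintro rfl; exact lt_irrefl _ hα_lt
  · rintro rfl; linarith
  · rintro rfl; linarith
end

section
/- Let A and B be finite nonempty subsets of ℝ × ℝ separated by the vertical line x = m. Let (α₁, α₂) be an upper supporting pair of A and (β₁, β₂) an upper supporting pair of B, let l be the midpoint of α₁α₂ and r the midpoint of β₁β₂, and assume slope(α₁α₂) > slope(lr) > slope(β₁β₂). Let γ be the intersection point of the line through α₁, α₂ and the line through β₁, β₂ (these lines meet in a unique point since their slopes differ). If γ₁ ≤ m, then every supporting pair (a, b) of (A, B) satisfies a₁ > (α₁)₁; in particular, no point of A whose x-coordinate is at most (α₁)₁ can be the left endpoint of a supporting pair. (Bridge-search case 3, subcase γ on or left of the separating line.) -/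
/-- A point is on or below a line iff its height over `p` is at most the slope times the run. -/
theorem onOrBelow_iff_segSlope {p q s : ℝ × ℝ} (h : p.1 < q.1) :
    OnOrBelow p q s ↔ s.2 ≤ p.2 + segSlope p q * (s.1 - p.1) := by
  have h' : 0 < q.1 - p.1 := sub_pos.mpr h
  have key : (s.1 - p.1) * (q.2 - p.2) = (q.1 - p.1) * (segSlope p q * (s.1 - p.1)) := by
    unfold segSlope
    field_simp
  rw [OnOrBelow, key, mul_le_mul_iff_right₀ h', sub_le_iff_le_add']

/-- A point is on a line iff its height over `p` equals the slope times the run. -/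
theorem onLine_iff_segSlope {p q s : ℝ × ℝ} (h : p.1 < q.1) :
    OnLine p q s ↔ s.2 = p.2 + segSlope p q * (s.1 - p.1) := by
  have h' : q.1 - p.1 ≠ 0 := (sub_pos.mpr h).ne'
  have key : (s.1 - p.1) * (q.2 - p.2) = (q.1 - p.1) * (segSlope p q * (s.1 - p.1)) := by
    unfold segSlope
    field_simp
  rw [OnLine, key, mul_right_inj' h', sub_eq_iff_eq_add']

theorem bridge_case3_left
    (A B : Finset (ℝ × ℝ)) (m : ℝ) (hA : A.Nonempty) (hB : B.Nonempty)
    (hsep : SeparatedBy A B m)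
    (α₁ α₂ β₁ β₂ : ℝ × ℝ)
    (hα : UpperSupportingPair A α₁ α₂) (hβ : UpperSupportingPair B β₁ β₂)
    (hslope₁ : segSlope (midpt α₁ α₂) (midpt β₁ β₂) < segSlope α₁ α₂)
    (hslope₂ : segSlope β₁ β₂ < segSlope (midpt α₁ α₂) (midpt β₁ β₂))
    (γ : ℝ × ℝ) (hγα : OnLine α₁ α₂ γ) (hγβ : OnLine β₁ β₂ γ)
    (hγm : γ.1 ≤ m) :
    ∀ a b : ℝ × ℝ, SupportingPair A B a b → α₁.1 < a.1 := by
  intro a b ⟨ha, hb, hab⟩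
  obtain ⟨-, hα₂, hαlt, hαA⟩ := hα
  obtain ⟨-, -, hβlt, hβB⟩ := hβ
  by_contra! hle
  have hslope := hslope₂.trans hslope₁
  have haα := (onOrBelow_iff_segSlope hαlt).mp (hαA a ha)
  have hbβ := (onOrBelow_iff_segSlope hβlt).mp (hβB b hb)
  have hα₂α := (onLine_iff_segSlope (s := α₂) hαlt).mp rfl
  have hα₂ab := hab α₂ (Finset.mem_union_left B hα₂)
  rw [onLine_iff_segSlope hαlt] at hγα
  rw [onLine_iff_segSlope hβlt] at hγβ
  have hα₂m := hsep.1 α₂ hα₂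
  have hbm := hsep.2 b hb
  generalize segSlope α₁ α₂ = k at *
  generalize segSlope β₁ β₂ = j at *
  have hbα : b.2 < α₁.2 + k * (b.1 - α₁.1) := by
    nlinarith [mul_pos (sub_pos.mpr hslope) (sub_pos.mpr (hγm.trans_lt hbm))]
  have hbpos := mul_pos (sub_pos.mpr (hle.trans_lt hαlt)) (sub_pos.mpr hbα)
  have hapos := mul_nonneg (sub_pos.mpr (hα₂m.trans hbm)).le (sub_nonneg.mpr haα)
  rw [OnOrBelow, hα₂α] at hα₂ab
  linarith
end

section
/- Let A and B be finite nonempty subsets of ℝ × ℝ separated by the vertical line x = m. Let (α₁, α₂) be an upper supporting pair of A and (β₁, β₂) an upper supporting pair of B, let l be the midpoint of α₁α₂ and r the midpoint of β₁β₂, and assume slope(α₁α₂) > slope(lr) > slope(β₁β₂). Let γ be the intersection point of the line through α₁, α₂ and the line through β₁, β₂. If γ₁ ≥ m, then every supporting pair (a, b) of (A, B) satisfies b₁ < (β₂)₁; in particular, no point of B whose x-coordinate is at least (β₂)₁ can be the right endpoint of a supporting pair. (Bridge-search case 3, subcase γ on or right of the separating line.) -/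
/-- Slope-intercept form, anchored at `γ`, of the line through `p` and `q`. -/
theorem OnLine.eq_mul_segSlope {p q γ : ℝ × ℝ} (hpq : p.1 < q.1) (h : OnLine p q γ) :
    γ.2 - p.2 = segSlope p q * (γ.1 - p.1) := by
  have hd : q.1 - p.1 ≠ 0 := (sub_pos.2 hpq).ne'
  unfold OnLine at h
  unfold segSlope
  field_simp
  linarith

theorem OnOrBelow.sub_le_mul_segSlope {p q s : ℝ × ℝ} (hpq : p.1 < q.1)
    (h : OnOrBelow p q s) : s.2 - p.2 ≤ segSlope p q * (s.1 - p.1) := by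
  have hd : 0 < q.1 - p.1 := sub_pos.2 hpq
  unfold OnOrBelow at h
  unfold segSlope
  rw [div_mul_eq_mul_div, le_div_iff₀ hd]
  linarith

theorem bridge_case3_right
    (A B : Finset (ℝ × ℝ)) (m : ℝ) (hA : A.Nonempty) (hB : B.Nonempty)
    (hsep : SeparatedBy A B m)
    (α₁ α₂ β₁ β₂ : ℝ × ℝ)
    (hα : UpperSupportingPair A α₁ α₂) (hβ : UpperSupportingPair B β₁ β₂)
    (hslope₁ : segSlope (midpt α₁ α₂) (midpt β₁ β₂) < segSlope α₁ α₂)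
    (hslope₂ : segSlope β₁ β₂ < segSlope (midpt α₁ α₂) (midpt β₁ β₂))
    (γ : ℝ × ℝ) (hγα : OnLine α₁ α₂ γ) (hγβ : OnLine β₁ β₂ γ)
    (hγm : m ≤ γ.1) :
    ∀ a b : ℝ × ℝ, SupportingPair A B a b → b.1 < β₂.1 := by
  intro a b ⟨haA, hbB, hab⟩
  obtain ⟨-, -, hα₁₂, hAα⟩ := hα
  obtain ⟨hβ₁, -, hβ₁₂, hBβ⟩ := hβ
  by_contra! hb
  have ha : a.1 < m := hsep.1 a haA
  have hmβ : m < β₁.1 := hsep.2 β₁ hβ₁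
  have hvu : segSlope β₁ β₂ < segSlope α₁ α₂ := hslope₂.trans hslope₁
  have hγα' := hγα.eq_mul_segSlope hα₁₂
  have hγβ' := hγβ.eq_mul_segSlope hβ₁₂
  have haα := (hAα a haA).sub_le_mul_segSlope hα₁₂
  have hbβ := (hBβ b hbB).sub_le_mul_segSlope hβ₁₂
  have hβab : OnOrBelow a b β₁ := hab β₁ (Finset.mem_union_right _ hβ₁)
  unfold OnOrBelow at hβab
  generalize segSlope β₁ β₂ = v at *
  generalize segSlope α₁ α₂ = u at *
  have haβ : a.2 - β₁.2 < v * (a.1 - β₁.1) := by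
    nlinarith [mul_pos (sub_pos.2 hvu) (sub_pos.2 (ha.trans_le hγm))]
  have h₁ : 0 < b.1 - β₁.1 := by linarith
  have h₂ : 0 < β₁.1 - a.1 := by linarith
  -- `β₁` lies strictly above the chord `ab`
  nlinarith [mul_pos h₁ (sub_pos.2 haβ), mul_nonneg h₂.le (sub_nonneg.2 hbβ)]
end

section
/- Let A and B be finite nonempty subsets of ℝ × ℝ separated by the vertical line x = m, let (a, b) be a supporting pair of (A, B), and let (β₁, β₂) be an upper supporting pair of B with midpoint r. If slope(ar) < slope(β₁β₂), then b₁ ≥ (β₂)₁; that is, the right endpoint of the upper bridge succeeds the edge β. (Right-endpoint search, second case.) -/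
theorem right_endpoint_case2
    (A B : Finset (ℝ × ℝ)) (m : ℝ) (hA : A.Nonempty) (hB : B.Nonempty)
    (hsep : SeparatedBy A B m)
    (a b : ℝ × ℝ) (hab : SupportingPair A B a b)
    (β₁ β₂ : ℝ × ℝ) (hβ : UpperSupportingPair B β₁ β₂)
    (hslope : segSlope a (midpt β₁ β₂) < segSlope β₁ β₂) :
    b.1 ≥ β₂.1 := by
  obtain ⟨ha, hb, hbridge⟩ := hab
  obtain ⟨h₁, h₂, hlt, hbelow⟩ := hβ
  by_contra! hcon
  have ha₁ := hsep.1 a ha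
  have hb₁ := hsep.2 b hb
  have hβ₁ := hsep.2 β₁ h₁
  have hβ₂ := hbridge β₂ (Finset.mem_union_right _ h₂)
  have hbβ := hbelow b hb
  unfold OnOrBelow at hβ₂ hbβ
  simp only [segSlope, midpt] at hslope
  have hd : 0 < β₂.1 - β₁.1 := by linarith
  obtain ⟨k, hk⟩ : ∃ k, k = (β₂.2 - β₁.2) / (β₂.1 - β₁.1) := ⟨_, rfl⟩
  rw [← hk, div_lt_iff₀ (by linarith)] at hslope
  rw [eq_div_iff hd.ne'] at hk
  -- `a` is strictly above, and `b` on or below, the line through `β₁` and `β₂`.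
  have hu : 0 < a.2 - β₂.2 - k * (a.1 - β₂.1) := by linarith
  have hv : 0 ≤ k * (b.1 - β₂.1) - (b.2 - β₂.2) := by
    rw [← hk] at hbβ
    have : b.2 - β₁.2 ≤ (b.1 - β₁.1) * k := by
      refine le_of_mul_le_mul_left ?_ hd
      linarith
    linarith
  have hub := mul_pos hu (sub_pos.2 hcon)
  have hva := mul_nonneg hv (show 0 ≤ β₂.1 - a.1 by linarith)
  linarith
end

section
/- Let A and B be finite nonempty subsets of ℝ × ℝ separated by the vertical line x = m. Then there exists a supporting pair of (A, B): a pair (a, b) ∈ A × B such that every point of A ∪ B lies on or below the line through a and b. (Existence of the upper bridge.) -/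
/-- The height at which the line through `p` and `q` crosses the vertical line `x = m`. -/
noncomputable def crossingHeight (m : ℝ) (p q : ℝ × ℝ) : ℝ :=
  (p.2 * (q.1 - m) + q.2 * (m - p.1)) / (q.1 - p.1)

theorem onOrBelow_of_crossingHeight_le_left {m : ℝ} {a b s : ℝ × ℝ}
    (ha : a.1 < m) (hb : m < b.1) (hs : s.1 < m)
    (h : crossingHeight m s b ≤ crossingHeight m a b) : OnOrBelow a b s := by
  unfold crossingHeight at h
  rw [div_le_div_iff₀ (by linarith) (by linarith)] at h
  unfold OnOrBelow
  refine le_of_mul_le_mul_left ?_ (sub_pos.2 hb)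
  linarith

theorem onOrBelow_of_crossingHeight_le_right {m : ℝ} {a b s : ℝ × ℝ}
    (ha : a.1 < m) (hb : m < b.1) (hs : m < s.1)
    (h : crossingHeight m a s ≤ crossingHeight m a b) : OnOrBelow a b s := by
  unfold crossingHeight at h
  rw [div_le_div_iff₀ (by linarith) (by linarith)] at h
  unfold OnOrBelow
  refine le_of_mul_le_mul_left ?_ (sub_pos.2 ha)
  linarith

theorem bridge_exists
    (A B : Finset (ℝ × ℝ)) (m : ℝ) (hA : A.Nonempty) (hB : B.Nonempty)
    (hsep : SeparatedBy A B m) :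
    ∃ a b : ℝ × ℝ, SupportingPair A B a b := by
  obtain ⟨⟨a, b⟩, hab, hmax⟩ := (A ×ˢ B).exists_max_image
    (fun p => crossingHeight m p.1 p.2) (hA.product hB)
  obtain ⟨ha, hb⟩ := Finset.mem_product.1 hab
  refine ⟨a, b, ha, hb, fun s hs => ?_⟩
  rcases Finset.mem_union.1 hs with hs | hs
  · exact onOrBelow_of_crossingHeight_le_left (hsep.1 a ha) (hsep.2 b hb) (hsep.1 s hs)
      (hmax (s, b) (Finset.mk_mem_product hs hb))
  · exact onOrBelow_of_crossingHeight_le_right (hsep.1 a ha) (hsep.2 b hb) (hsep.2 s hs)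
      (hmax (a, s) (Finset.mk_mem_product ha hs))
end

section
/- Let A and B be finite nonempty subsets of ℝ × ℝ separated by the vertical line x = m. If (a, b) and (a′, b′) are both supporting pairs of (A, B), then the four points a, b, a′, b′ are collinear; in other words, all supporting pairs of (A, B) lie on one common line, so the upper tangent line of A and B is unique. -/
/-- If one affine function is nonnegative at points on both sides of `m`, and nonpositive at points
on both sides of `m`, then it vanishes. -/
theorem affine_coeffs_eq_zero {c e m x y x' y' : ℝ} (hx : x < m) (hy : m < y) (hx' : x' < m)
    (hy' : m < y') (h1 : c + e * (x - m) ≤ 0) (h2 : c + e * (y - m) ≤ 0)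
    (h3 : 0 ≤ c + e * (x' - m)) (h4 : 0 ≤ c + e * (y' - m)) : c = 0 ∧ e = 0 := by
  have he : e = 0 := by
    rcases lt_trichotomy e 0 with he | he | he
    · nlinarith [mul_pos_of_neg_of_neg he (sub_neg.2 hx), mul_neg_of_neg_of_pos he (sub_pos.2 hy')]
    · exact he
    · nlinarith [mul_pos he (sub_pos.2 hy), mul_neg_of_pos_of_neg he (sub_neg.2 hx')]
  subst he
  exact ⟨by linarith, rfl⟩

/-- A supporting pair of separated sets lies on the graph of an affine function which bounds both
sets from above. -/
theorem SupportingPair.exists_affine {A B : Finset (ℝ × ℝ)} {m : ℝ} {a b : ℝ × ℝ}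
    (hsep : SeparatedBy A B m) (hab : SupportingPair A B a b) :
    ∃ c k : ℝ, a.2 = c + k * (a.1 - m) ∧ b.2 = c + k * (b.1 - m) ∧
      ∀ s ∈ A ∪ B, s.2 ≤ c + k * (s.1 - m) := by
  obtain ⟨ha, hb, h⟩ := hab
  have hlt : 0 < b.1 - a.1 := by linarith [hsep.1 a ha, hsep.2 b hb]
  obtain ⟨k, hk⟩ : ∃ k, b.2 - a.2 = k * (b.1 - a.1) :=
    ⟨(b.2 - a.2) / (b.1 - a.1), by field_simp⟩
  refine ⟨a.2 + k * (m - a.1), k, by ring, by linarith, fun s hs => ?_⟩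
  have hs' := h s hs
  rw [OnOrBelow, hk] at hs'
  have : s.2 - a.2 ≤ (s.1 - a.1) * k := le_of_mul_le_mul_left (by linarith) hlt
  linarith

theorem bridge_line_unique
    (A B : Finset (ℝ × ℝ)) (m : ℝ) (hA : A.Nonempty) (hB : B.Nonempty)
    (hsep : SeparatedBy A B m)
    (a b a' b' : ℝ × ℝ)
    (hab : SupportingPair A B a b) (hab' : SupportingPair A B a' b') :
    Collinear ℝ ({a, b, a', b'} : Set (ℝ × ℝ)) := by
  obtain ⟨c, k, ha, hb, h⟩ := hab.exists_affine hsep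
  obtain ⟨c', k', ha', hb', h'⟩ := hab'.exists_affine hsep
  have h1 := h' a (Finset.mem_union_left _ hab.1)
  have h2 := h' b (Finset.mem_union_right _ hab.2.1)
  have h3 := h a' (Finset.mem_union_left _ hab'.1)
  have h4 := h b' (Finset.mem_union_right _ hab'.2.1)
  obtain ⟨hc, hk⟩ := affine_coeffs_eq_zero (c := c - c') (e := k - k') (hsep.1 a hab.1)
    (hsep.2 b hab.2.1) (hsep.1 a' hab'.1) (hsep.2 b' hab'.2.1)
    (by linarith) (by linarith) (by linarith) (by linarith)
  obtain rfl := sub_eq_zero.1 hc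
  obtain rfl := sub_eq_zero.1 hk
  rw [collinear_iff_exists_forall_eq_smul_vadd]
  refine ⟨(m, c), (1, k), fun p hp => ⟨p.1 - m, ?_⟩⟩
  have hp2 : p.2 = c + k * (p.1 - m) := by
    rcases hp with rfl | rfl | rfl | rfl <;> assumption
  ext
  · simp
  · simp only [hp2, vadd_eq_add, Prod.snd_add, Prod.smul_snd, smul_eq_mul]
    ring
end

section
/- Let A and B be finite nonempty subsets of ℝ × ℝ separated by the vertical line x = m. Then there exists exactly one supporting pair (a, b) of (A, B) that is maximal, i.e., such that every supporting pair (a′, b′) of (A, B) satisfies a₁ ≤ a′₁ and b′₁ ≤ b₁. (Well-definedness of the maximal bridge: the maximal segment between A and B whose supporting line does not separate A ∪ B exists and is unique.) -/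
/-- If `p` and `q` lie on the line `y = k * x + c`, then `OnOrBelow p q` is the closed half-plane
below that line. -/
theorem onOrBelow_iff_le_of_mem_line {p q : ℝ × ℝ} {k c : ℝ} (hpq : p.1 < q.1)
    (hp : p.2 = k * p.1 + c) (hq : q.2 = k * q.1 + c) (s : ℝ × ℝ) :
    OnOrBelow p q s ↔ s.2 ≤ k * s.1 + c := by
  have hd : 0 < q.1 - p.1 := sub_pos.2 hpq
  have key : (s.1 - p.1) * (q.2 - p.2) - (q.1 - p.1) * (s.2 - p.2)
      = (q.1 - p.1) * (k * s.1 + c - s.2) := by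
    rw [hp, hq]; ring
  rw [OnOrBelow, ← sub_nonneg, key, mul_nonneg_iff_of_pos_left hd, sub_nonneg]

/-- Two points with distinct `x`-coordinates lie on a common non-vertical line. -/
theorem exists_line_through {p q : ℝ × ℝ} (hpq : p.1 < q.1) :
    ∃ k c : ℝ, p.2 = k * p.1 + c ∧ q.2 = k * q.1 + c := by
  have hd : q.1 - p.1 ≠ 0 := (sub_pos.2 hpq).ne'
  refine ⟨(q.2 - p.2) / (q.1 - p.1), p.2 - (q.2 - p.2) / (q.1 - p.1) * p.1, by ring, ?_⟩
  field_simp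
  ring

/-- A segment across `x = m` with both endpoints on or above a line, and at least one of them
strictly above it, crosses `x = m` strictly above that line. -/
theorem lt_crossingHeight {m k c : ℝ} {p q : ℝ × ℝ} (hp : p.1 < m) (hq : m < q.1)
    (hpl : k * p.1 + c ≤ p.2) (hql : k * q.1 + c ≤ q.2)
    (h : k * p.1 + c < p.2 ∨ k * q.1 + c < q.2) : k * m + c < crossingHeight m p q := by
  rw [crossingHeight, lt_div_iff₀ (by linarith)]
  have h₁ : 0 < q.1 - m := sub_pos.2 hq
  have h₂ : 0 < m - p.1 := sub_pos.2 hp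
  rcases h with h | h
  · nlinarith [mul_pos h₁ (sub_pos.2 h), mul_nonneg h₂.le (sub_nonneg.2 hql)]
  · nlinarith [mul_pos h₂ (sub_pos.2 h), mul_nonneg h₁.le (sub_nonneg.2 hpl)]

theorem crossingHeight_of_mem_line {m k c : ℝ} {p q : ℝ × ℝ} (hpq : p.1 < q.1)
    (hp : p.2 = k * p.1 + c) (hq : q.2 = k * q.1 + c) : crossingHeight m p q = k * m + c := by
  rw [crossingHeight, div_eq_iff (sub_pos.2 hpq).ne', hp, hq]
  ring

/-- Separated sets have a common upper supporting line that touches both. -/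
theorem exists_common_supporting_line {A B : Finset (ℝ × ℝ)} {m : ℝ} (hA : A.Nonempty)
    (hB : B.Nonempty) (hsep : SeparatedBy A B m) :
    ∃ k c : ℝ, (∀ s ∈ A ∪ B, s.2 ≤ k * s.1 + c) ∧
      (∃ a ∈ A, a.2 = k * a.1 + c) ∧ ∃ b ∈ B, b.2 = k * b.1 + c := by
  obtain ⟨⟨a, b⟩, hab, hmax⟩ :=
    (A ×ˢ B).exists_max_image (fun z => crossingHeight m z.1 z.2) (hA.product hB)
  obtain ⟨ha, hb⟩ := Finset.mem_product.1 hab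
  have hlt : a.1 < b.1 := (hsep.1 a ha).trans (hsep.2 b hb)
  obtain ⟨k, c, hak, hbk⟩ := exists_line_through hlt
  have hle : ∀ a' ∈ A, ∀ b' ∈ B, crossingHeight m a' b' ≤ k * m + c := fun a' ha' b' hb' =>
    (hmax (a', b') (Finset.mk_mem_product ha' hb')).trans_eq
      (crossingHeight_of_mem_line hlt hak hbk)
  refine ⟨k, c, fun s hs => ?_, ⟨a, ha, hak⟩, b, hb, hbk⟩
  by_contra! h
  rcases Finset.mem_union.1 hs with hs | hs
  · exact (lt_crossingHeight (hsep.1 s hs) (hsep.2 b hb) h.le hbk.ge (.inl h)).not_ge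
      (hle s hs b hb)
  · exact (lt_crossingHeight (hsep.1 a ha) (hsep.2 s hs) hak.ge h.le (.inr h)).not_ge
      (hle a ha s hs)

/-- The supporting pairs are the pairs of points on the common upper supporting line. -/
theorem supportingPair_iff_mem_line {A B : Finset (ℝ × ℝ)} {m k c : ℝ}
    (hsep : SeparatedBy A B m) (hle : ∀ s ∈ A ∪ B, s.2 ≤ k * s.1 + c)
    (hA : ∃ a ∈ A, a.2 = k * a.1 + c) (hB : ∃ b ∈ B, b.2 = k * b.1 + c) (a b : ℝ × ℝ) :
    SupportingPair A B a b ↔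
      (a ∈ A ∧ a.2 = k * a.1 + c) ∧ (b ∈ B ∧ b.2 = k * b.1 + c) := by
  constructor
  · rintro ⟨ha, hb, hs⟩
    have ham := hsep.1 a ha
    have hbm := hsep.2 b hb
    obtain ⟨k', c', hak, hbk⟩ := exists_line_through (ham.trans hbm)
    simp only [onOrBelow_iff_le_of_mem_line (ham.trans hbm) hak hbk] at hs
    obtain ⟨a₀, ha₀, ha₀k⟩ := hA
    obtain ⟨b₀, hb₀, hb₀k⟩ := hB
    have ha₀m := hsep.1 a₀ ha₀
    have hb₀m := hsep.2 b₀ hb₀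
    have hal := hle a (Finset.mem_union_left _ ha)
    have hbl := hle b (Finset.mem_union_right _ hb)
    have ha₀s := hs a₀ (Finset.mem_union_left _ ha₀)
    have hb₀s := hs b₀ (Finset.mem_union_right _ hb₀)
    have hm : k * m + c ≤ k' * m + c' := by
      by_contra! h
      rcases le_total k k' with hk | hk <;> nlinarith
    refine ⟨⟨ha, hal.antisymm ?_⟩, hb, hbl.antisymm ?_⟩ <;>
    · by_contra! h
      rcases le_total k k' with hk | hk <;> nlinarith
  · rintro ⟨⟨ha, hak⟩, hb, hbk⟩
    have hlt : a.1 < b.1 := (hsep.1 a ha).trans (hsep.2 b hb)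
    exact ⟨ha, hb, fun s hs => (onOrBelow_iff_le_of_mem_line hlt hak hbk s).2 (hle s hs)⟩

theorem maximal_bridge_exists_unique
    (A B : Finset (ℝ × ℝ)) (m : ℝ) (hA : A.Nonempty) (hB : B.Nonempty)
    (hsep : SeparatedBy A B m) :
    ∃! ab : (ℝ × ℝ) × (ℝ × ℝ),
      SupportingPair A B ab.1 ab.2 ∧
      ∀ a' b' : ℝ × ℝ, SupportingPair A B a' b' → ab.1.1 ≤ a'.1 ∧ b'.1 ≤ ab.2.1 := by
  obtain ⟨k, c, hle, hAk, hBk⟩ := exists_common_supporting_line hA hB hsep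
  simp only [supportingPair_iff_mem_line hsep hle hAk hBk]
  obtain ⟨a, ha, hamin⟩ := (A.filter fun s => s.2 = k * s.1 + c).exists_min_image Prod.fst
    (Finset.filter_nonempty_iff.2 hAk)
  obtain ⟨b, hb, hbmax⟩ := (B.filter fun s => s.2 = k * s.1 + c).exists_max_image Prod.fst
    (Finset.filter_nonempty_iff.2 hBk)
  simp only [Finset.mem_filter] at ha hamin hb hbmax
  refine ⟨(a, b), ⟨⟨ha, hb⟩, fun a' b' h => ⟨hamin a' h.1, hbmax b' h.2⟩⟩, ?_⟩
  rintro ⟨a', b'⟩ ⟨⟨ha', hb'⟩, hext⟩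
  obtain ⟨ha'a, hbb'⟩ := hext a b ⟨ha, hb⟩
  have hax : a'.1 = a.1 := ha'a.antisymm (hamin a' ha')
  have hbx : b'.1 = b.1 := (hbmax b' hb').antisymm hbb'
  exact Prod.ext (Prod.ext hax (by rw [ha'.2, ha.2, hax]))
    (Prod.ext hbx (by rw [hb'.2, hb.2, hbx]))
end

section
/- Let A and B be finite nonempty subsets of ℝ × ℝ separated by the vertical line x = m, and assume A ∪ B is in general position. Then for every supporting pair (a, b) of (A, B): the point a is an upper-hull vertex of A and also an upper-hull vertex of A ∪ B, and the point b is an upper-hull vertex of B and also an upper-hull vertex of A ∪ B. (The endpoints of the upper bridge lie on the upper convex hulls of A and B, respectively.) -/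
/-- If the line of slope `k` through `p ∈ S` passes through `q` and lies strictly above every other
point of `S`, then tilting it slightly about `p` puts `q` strictly below it as well. -/
theorem upperHullVertex_of_strictly_below_line {S : Finset (ℝ × ℝ)} {p q : ℝ × ℝ} {k : ℝ}
    (hp : p ∈ S) (hpq : q.1 ≠ p.1) (hq : q.2 = p.2 + k * (q.1 - p.1))
    (h : ∀ s ∈ S, s ≠ p → s ≠ q → s.2 < p.2 + k * (s.1 - p.1)) :
    UpperHullVertex S p := by
  have tilt : ∀ᶠ ε in nhdsWithin (0 : ℝ) (Set.Ioi 0), ∀ s ∈ S, s ≠ p →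
      s.2 < p.2 + (k + ε * (q.1 - p.1)) * (s.1 - p.1) := by
    rw [Filter.eventually_all_finset]
    intro s hs
    by_cases hsp : s = p
    · simp [hsp]
    by_cases hsq : s = q
    · subst hsq
      filter_upwards [self_mem_nhdsWithin] with ε hε _
      have hpos : 0 < ε * (s.1 - p.1) ^ 2 :=
        mul_pos hε (pow_pos (abs_pos.2 (sub_ne_zero.2 hpq)) 2 |>.trans_eq (sq_abs _))
      linarith
    · have hcont : Continuous fun ε : ℝ => p.2 + (k + ε * (q.1 - p.1)) * (s.1 - p.1) := by
        fun_prop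
      have hlt : s.2 < p.2 + (k + 0 * (q.1 - p.1)) * (s.1 - p.1) := by
        simpa using h s hs hsp hsq
      filter_upwards [nhdsWithin_le_nhds (hcont.continuousAt.eventually_const_lt hlt)]
        with ε hε _ using hε
  obtain ⟨ε, hε⟩ := tilt.exists
  exact ⟨hp, _, hε⟩

theorem UpperHullVertex.mono {S T : Finset (ℝ × ℝ)} {p : ℝ × ℝ} (h : UpperHullVertex T p)
    (hST : S ⊆ T) (hp : p ∈ S) : UpperHullVertex S p := by
  obtain ⟨-, k, hk⟩ := h
  exact ⟨hp, k, fun s hs => hk s (hST hs)⟩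

theorem OnLine.collinear {p q s : ℝ × ℝ} (hpq : p.1 < q.1) (h : OnLine p q s) :
    Collinear ℝ ({p, q, s} : Set (ℝ × ℝ)) := by
  have hne : q.1 - p.1 ≠ 0 := (sub_pos.2 hpq).ne'
  refine (collinear_iff_of_mem (Set.mem_insert p _)).2 ⟨q - p, ?_⟩
  simp only [Set.mem_insert_iff, Set.mem_singleton_iff, forall_eq_or_imp, forall_eq]
  refine ⟨⟨0, by simp⟩, ⟨1, by simp⟩, (s.1 - p.1) / (q.1 - p.1), ?_⟩
  unfold OnLine at h
  ext
  · simp [hne]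
  · simp only [vadd_eq_add, Prod.snd_add, Prod.smul_snd, Prod.snd_sub, smul_eq_mul]
    field_simp
    linarith

/-- In general position, a supporting pair spans an edge of the upper hull. -/
theorem UpperSupportingPair.upperHullEdge {S : Finset (ℝ × ℝ)} {p q : ℝ × ℝ}
    (h : UpperSupportingPair S p q) (hS : GeneralPosition S) : UpperHullEdge S p q := by
  obtain ⟨hp, hq, hpq, hle⟩ := h
  refine ⟨hp, hq, hpq, fun s hs hsp hsq => lt_of_le_of_ne (hle s hs) fun heq => ?_⟩
  exact hS p hp q hq s hs (fun e => hpq.ne (congrArg Prod.fst e)) hsp.symm hsq.symm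
    (OnLine.collinear hpq heq)

theorem StrictlyBelow.snd_lt {p q s : ℝ × ℝ} (hpq : p.1 < q.1) (h : StrictlyBelow p q s) :
    s.2 < p.2 + segSlope p q * (s.1 - p.1) := by
  have hpos : 0 < q.1 - p.1 := sub_pos.2 hpq
  unfold StrictlyBelow at h
  rw [segSlope, div_mul_eq_mul_div, ← sub_lt_iff_lt_add', lt_div_iff₀ hpos]
  linarith

theorem segSlope_mul_sub {p q : ℝ × ℝ} (hpq : p.1 < q.1) :
    segSlope p q * (q.1 - p.1) = q.2 - p.2 :=
  div_mul_cancel₀ _ (sub_pos.2 hpq).ne'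

theorem UpperHullEdge.upperHullVertex_left {S : Finset (ℝ × ℝ)} {p q : ℝ × ℝ}
    (h : UpperHullEdge S p q) : UpperHullVertex S p := by
  obtain ⟨hp, -, hpq, hlt⟩ := h
  refine upperHullVertex_of_strictly_below_line (k := segSlope p q) hp hpq.ne' ?_
    fun s hs hsp hsq => (hlt s hs hsp hsq).snd_lt hpq
  linarith [segSlope_mul_sub hpq]

theorem UpperHullEdge.upperHullVertex_right {S : Finset (ℝ × ℝ)} {p q : ℝ × ℝ}
    (h : UpperHullEdge S p q) : UpperHullVertex S q := by
  obtain ⟨-, hq, hpq, hlt⟩ := h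
  have hslope := segSlope_mul_sub hpq
  refine upperHullVertex_of_strictly_below_line (q := p) (k := segSlope p q) hq hpq.ne ?_
    fun s hs hsq hsp => ?_
  · linarith
  · linarith [(hlt s hs hsp hsq).snd_lt hpq]

theorem bridge_endpoints_on_hulls
    (A B : Finset (ℝ × ℝ)) (m : ℝ) (hA : A.Nonempty) (hB : B.Nonempty)
    (hsep : SeparatedBy A B m) (hgp : GeneralPosition (A ∪ B)) :
    ∀ a b : ℝ × ℝ, SupportingPair A B a b →
      UpperHullVertex A a ∧ UpperHullVertex (A ∪ B) a ∧
      UpperHullVertex B b ∧ UpperHullVertex (A ∪ B) b := by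
  intro a b ⟨ha, hb, hle⟩
  have hab : a.1 < b.1 := (hsep.1 a ha).trans (hsep.2 b hb)
  have hedge : UpperHullEdge (A ∪ B) a b := UpperSupportingPair.upperHullEdge
    ⟨Finset.mem_union_left B ha, Finset.mem_union_right A hb, hab, hle⟩ hgp
  exact ⟨hedge.upperHullVertex_left.mono Finset.subset_union_left ha, hedge.upperHullVertex_left,
    hedge.upperHullVertex_right.mono Finset.subset_union_right hb, hedge.upperHullVertex_right⟩
end

section
/- Let A and B be finite nonempty subsets of ℝ × ℝ separated by the vertical line x = m, let (a, b) be a supporting pair of (A, B), and let (β₁, β₂) be an upper supporting pair of B. Then b₁ ≤ (β₁)₁, or b₁ ≥ (β₂)₁, or b l lies on the line through β₁ and β₂. (The right endpoint of the upper bridge never lies strictly between the endpoints of an upper-hull edge of B except on its supporting line; this dichotomy underlies the binary search for the right bridge endpoint.) -/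
theorem bridge_endpoint_trichotomy
    (A B : Finset (ℝ × ℝ)) (m : ℝ) (hA : A.Nonempty) (hB : B.Nonempty)
    (hsep : SeparatedBy A B m)
    (a b : ℝ × ℝ) (hab : SupportingPair A B a b)
    (β₁ β₂ : ℝ × ℝ) (hβ : UpperSupportingPair B β₁ β₂) :
    b.1 ≤ β₁.1 ∨ b.1 ≥ β₂.1 ∨ OnLine β₁ β₂ b := by
  obtain ⟨ha, hb, hbelow⟩ := hab
  obtain ⟨h₁, h₂, -, hle⟩ := hβ
  by_contra! hcon
  obtain ⟨hleft, hright, hline⟩ := hcon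
  have hpos : 0 < b.1 - a.1 := sub_pos.2 ((hsep.1 a ha).trans (hsep.2 b hb))
  have hβ₁ := hbelow β₁ (Finset.mem_union_right A h₁)
  have hβ₂ := hbelow β₂ (Finset.mem_union_right A h₂)
  have hlt := lt_of_le_of_ne (hle b hb) hline
  unfold OnOrBelow at hβ₁ hβ₂
  have hcomb₁ := mul_le_mul_of_nonneg_left hβ₁ (sub_pos.2 hright).le
  have hcomb₂ := mul_le_mul_of_nonneg_left hβ₂ (sub_pos.2 hleft).le
  have hscaled := mul_lt_mul_of_pos_left hlt hpos
  linarith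
end

section
/- Let P be a finite subset of ℝ × ℝ with at least two points, and let q ∈ ℝ × ℝ be a point such that q₁ is strictly greater than the minimum x-coordinate of P, strictly less than the maximum x-coordinate of P, and different from the x-coordinate of every point of P. Then q belongs to the convex hull of P (as a subset of ℝ × ℝ) if and only if both of the following hold: (i) there exist u₁, u₂ ∈ P with (u₁)₁ < q₁ < (u₂)₁ such that every point of P lies on or below the line through u₁ and u₂ and q lies on or below that line; and (ii) there exist l₁, l₂ ∈ P with (l₁)₁ < q₁ < (l₂)₁ such that every point of P lies on or above the line through l₁ and l₂ and q lies on or above that line. (Correctness of the point-in-convex-hull query via the upper and lower hulls.) -/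
/-- Among the segments from points left of `c` to points right of `c`, one that meets the vertical
line at `c` at the greatest height has every point on or below the line it spans. -/
theorem exists_supporting_pair {α : Type*} (P : Finset α) (x y : α → ℝ) (c : ℝ)
    (hl : ∃ a ∈ P, x a < c) (hr : ∃ b ∈ P, c < x b) (hc : ∀ s ∈ P, x s ≠ c) :
    ∃ a ∈ P, ∃ b ∈ P, x a < c ∧ c < x b ∧
      ∀ s ∈ P, (x b - x a) * (y s - y a) ≤ (x s - x a) * (y b - y a) := by
  classical
  obtain ⟨a₀, ha₀, ha₀c⟩ := hl
  obtain ⟨b₀, hb₀, hb₀c⟩ := hr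
  let height : α × α → ℝ := fun p =>
    (y p.1 * (x p.2 - c) + y p.2 * (c - x p.1)) / (x p.2 - x p.1)
  obtain ⟨⟨a, b⟩, hab, hmax⟩ := Finset.exists_max_image
    ((P.filter fun a => x a < c) ×ˢ (P.filter fun b => c < x b)) height
    ⟨(a₀, b₀), by simp [*]⟩
  simp only [Finset.mem_product, Finset.mem_filter, Prod.forall] at hab hmax
  obtain ⟨⟨ha, hac⟩, hb, hbc⟩ := hab
  refine ⟨a, ha, b, hb, hac, hbc, fun s hs => ?_⟩
  rcases lt_or_gt_of_ne (hc s hs) with h | h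
  · have key := hmax s b ⟨⟨hs, h⟩, hb, hbc⟩
    rw [div_le_div_iff₀ (by linarith) (by linarith)] at key
    have hpos : 0 < x b - c := by linarith
    refine le_of_mul_le_mul_left ?_ hpos
    linear_combination key
  · have key := hmax a s ⟨⟨ha, hac⟩, hs, h⟩
    rw [div_le_div_iff₀ (by linarith) (by linarith)] at key
    have hpos : 0 < c - x a := by linarith
    refine le_of_mul_le_mul_left ?_ hpos
    linear_combination key

theorem convex_setOf_onOrBelow (p q : ℝ × ℝ) : Convex ℝ {s | OnOrBelow p q s} := by
  intro s hs t ht a b ha hb hab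
  simp only [Set.mem_ofPred_eq, OnOrBelow, Prod.fst_add, Prod.snd_add, Prod.smul_fst,
    Prod.smul_snd, smul_eq_mul] at hs ht ⊢
  obtain rfl : b = 1 - a := by linarith
  linear_combination a * hs + (1 - a) * ht

theorem convex_setOf_onOrAbove (p q : ℝ × ℝ) : Convex ℝ {s | OnOrAbove p q s} := by
  intro s hs t ht a b ha hb hab
  simp only [Set.mem_ofPred_eq, OnOrAbove, ge_iff_le, Prod.fst_add, Prod.snd_add, Prod.smul_fst,
    Prod.smul_snd, smul_eq_mul] at hs ht ⊢
  obtain rfl : b = 1 - a := by linarith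
  linear_combination a * hs + (1 - a) * ht

theorem Convex.exists_mem_onLine {C : Set (ℝ × ℝ)} (hC : Convex ℝ C) {u v : ℝ × ℝ}
    (hu : u ∈ C) (hv : v ∈ C) {c : ℝ} (huc : u.1 < c) (hcv : c < v.1) :
    ∃ t, (c, t) ∈ C ∧ OnLine u v (c, t) := by
  have hpos : 0 < v.1 - u.1 := by linarith
  refine ⟨(v.1 - c) / (v.1 - u.1) * u.2 + (c - u.1) / (v.1 - u.1) * v.2, ?_, ?_⟩
  · have hmem := hC hu hv (div_nonneg (sub_nonneg.2 hcv.le) hpos.le)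
      (div_nonneg (sub_nonneg.2 huc.le) hpos.le) (by field_simp; ring)
    convert hmem using 1
    ext
    · simp only [Prod.fst_add, Prod.smul_fst, smul_eq_mul]
      field_simp
      ring
    · simp
  · simp only [OnLine]
    field_simp
    ring

theorem Convex.mk_mem_of_mem_Icc {C : Set (ℝ × ℝ)} (hC : Convex ℝ C) {c a b t : ℝ}
    (ha : (c, a) ∈ C) (hb : (c, b) ∈ C) (ht : t ∈ Set.Icc a b) : (c, t) ∈ C := by
  apply hC.segment_subset ha hb
  rw [← Prod.image_mk_segment_right]
  exact ⟨t, Icc_subset_segment ht, rfl⟩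

theorem point_in_hull_iff
    (P : Finset (ℝ × ℝ)) (hcard : 2 ≤ P.card) (hne : P.Nonempty)
    (q : ℝ × ℝ)
    (hmin : P.inf' hne (fun p => p.1) < q.1)
    (hmax : q.1 < P.sup' hne (fun p => p.1))
    (hdist : ∀ p ∈ P, p.1 ≠ q.1) :
    q ∈ convexHull ℝ (P : Set (ℝ × ℝ)) ↔
      ((∃ u₁ ∈ P, ∃ u₂ ∈ P, u₁.1 < q.1 ∧ q.1 < u₂.1 ∧
          (∀ s ∈ P, OnOrBelow u₁ u₂ s) ∧ OnOrBelow u₁ u₂ q) ∧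
       (∃ l₁ ∈ P, ∃ l₂ ∈ P, l₁.1 < q.1 ∧ q.1 < l₂.1 ∧
          (∀ s ∈ P, OnOrAbove l₁ l₂ s) ∧ OnOrAbove l₁ l₂ q)) := by
  constructor
  · intro hq
    have hl : ∃ a ∈ P, a.1 < q.1 := (Finset.inf'_lt_iff hne).1 hmin
    have hr : ∃ b ∈ P, q.1 < b.1 := (Finset.lt_sup'_iff hne).1 hmax
    constructor
    · obtain ⟨a, ha, b, hb, hac, hbc, h⟩ := 
        exists_supporting_pair P Prod.fst Prod.snd q.1 hl hr hdist
      exact ⟨a, ha, b, hb, hac, hbc, h, convexHull_min h (convex_setOf_onOrBelow a b) hq⟩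
    · obtain ⟨a, ha, b, hb, hac, hbc, h⟩ :=
        exists_supporting_pair P Prod.fst (fun s => -s.2) q.1 hl hr hdist
      have habove : ∀ s ∈ P, OnOrAbove a b s := fun s hs => by
        simp only [OnOrAbove, ge_iff_le]
        linear_combination h s hs
      exact ⟨a, ha, b, hb, hac, hbc, habove,
        convexHull_min habove (convex_setOf_onOrAbove a b) hq⟩
  · rintro ⟨⟨u₁, hu₁, u₂, hu₂, hu₁q, hqu₂, -, hqu⟩, l₁, hl₁, l₂, hl₂, hl₁q, hql₂, -, hql⟩
    have hC := convex_convexHull ℝ (P : Set (ℝ × ℝ))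
    have hsub := subset_convexHull ℝ (P : Set (ℝ × ℝ))
    obtain ⟨t, htC, ht⟩ := hC.exists_mem_onLine (hsub hu₁) (hsub hu₂) hu₁q hqu₂
    obtain ⟨r, hrC, hr⟩ := hC.exists_mem_onLine (hsub hl₁) (hsub hl₂) hl₁q hql₂
    refine hC.mk_mem_of_mem_Icc hrC htC ⟨?_, ?_⟩
    · have hpos : 0 < l₂.1 - l₁.1 := by linarith
      simp only [OnLine, OnOrAbove, ge_iff_le] at hr hql
      refine le_of_mul_le_mul_left ?_ hpos
      linear_combination hr + hql
    · have hpos : 0 < u₂.1 - u₁.1 := by linarith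
      simp only [OnLine, OnOrBelow] at ht hqu
      refine le_of_mul_le_mul_left ?_ hpos
      linear_combination hqu - ht
end

section
/- Let P be a finite subset of ℝ × ℝ with at least two points, in general position and with pairwise distinct x-coordinates, and let t ∈ ℝ be strictly greater than the minimum x-coordinate of P, strictly less than the maximum x-coordinate of P, and different from the x-coordinate of every point of P. Then there exists exactly one edge (p, q) of the upper convex hull of P with p₁ < t < q₁. (Existence and uniqueness of the upper-hull edge spanning a given generic x-value, used in answering convex-hull queries.) -/
/-- The height at abscissa `t` of the line through `p` and `q`. -/
noncomputable def heightAt (t : ℝ) (p q : ℝ × ℝ) : ℝ :=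
  (p.2 * (q.1 - t) + q.2 * (t - p.1)) / (q.1 - p.1)

/-- The amount by which `s` lies above the line through `p` and `q`, scaled by `q.1 - p.1`. -/
def lineExcess (p q s : ℝ × ℝ) : ℝ :=
  (q.1 - p.1) * (s.2 - p.2) - (s.1 - p.1) * (q.2 - p.2)

theorem lineExcess_left (p q : ℝ × ℝ) : lineExcess p q p = 0 := by
  simp [lineExcess]

theorem lineExcess_right (p q : ℝ × ℝ) : lineExcess p q q = 0 := by
  simp [lineExcess]

theorem strictlyBelow_iff_lineExcess_neg {p q s : ℝ × ℝ} :
    StrictlyBelow p q s ↔ lineExcess p q s < 0 :=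
  sub_neg.symm

theorem heightAt_sub_heightAt {t : ℝ} {p q a b : ℝ × ℝ} (hpq : p.1 < q.1) (hab : a.1 < b.1) :
    heightAt t a b - heightAt t p q =
      ((b.1 - t) * lineExcess p q a + (t - a.1) * lineExcess p q b) /
        ((b.1 - a.1) * (q.1 - p.1)) := by
  have hpq' : q.1 - p.1 ≠ 0 := (sub_pos.2 hpq).ne'
  have hab' : b.1 - a.1 ≠ 0 := (sub_pos.2 hab).ne'
  unfold heightAt lineExcess
  field_simp
  ring

theorem collinear_of_lineExcess_eq_zero {p q s : ℝ × ℝ} (hpq : p.1 < q.1)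
    (h : lineExcess p q s = 0) : Collinear ℝ ({p, q, s} : Set (ℝ × ℝ)) := by
  have hpq' : q.1 - p.1 ≠ 0 := (sub_pos.2 hpq).ne'
  rw [collinear_iff_of_mem (p₀ := p) (by simp)]
  refine ⟨q - p, ?_⟩
  rintro r (rfl | rfl | rfl)
  · exact ⟨0, by simp⟩
  · exact ⟨1, by simp⟩
  · refine ⟨(r.1 - p.1) / (q.1 - p.1), Prod.ext ?_ ?_⟩
    · simp [hpq']
    · simp only [vadd_eq_add, Prod.snd_add, Prod.smul_snd, Prod.snd_sub, smul_eq_mul]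
      unfold lineExcess at h
      field_simp
      linarith

/-- A pair of points of `S` on the two sides of `x = t` maximizing the height at `t` spans
an edge of the upper hull. -/
theorem upperHullEdge_of_heightAt_max {S : Finset (ℝ × ℝ)} (hgp : GeneralPosition S) {t : ℝ}
    (hdist : ∀ p ∈ S, p.1 ≠ t) {p q : ℝ × ℝ} (hp : p ∈ S) (hq : q ∈ S)
    (hpt : p.1 < t) (htq : t < q.1)
    (hmax : ∀ a ∈ S, ∀ b ∈ S, a.1 < t → t < b.1 → heightAt t a b ≤ heightAt t p q) :
    UpperHullEdge S p q := by
  have hpq := hpt.trans htq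
  refine ⟨hp, hq, hpq, fun s hs hsp hsq => strictlyBelow_iff_lineExcess_neg.2 ?_⟩
  have hne : lineExcess p q s ≠ 0 := fun h =>
    hgp p hp q hq s hs (fun e => hpq.ne (congrArg Prod.fst e)) hsp.symm hsq.symm
      (collinear_of_lineExcess_eq_zero hpq h)
  refine lt_of_le_of_ne (not_lt.1 fun hpos => ?_) hne
  rcases lt_or_gt_of_ne (hdist s hs) with hst | hst
  · have hle := sub_nonpos.2 (hmax s hs q hq hst htq)
    rw [heightAt_sub_heightAt hpq (hst.trans htq), lineExcess_right, mul_zero, add_zero] at hle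
    have := sub_pos.2 htq
    have := sub_pos.2 hpq
    have := sub_pos.2 (hst.trans htq)
    exact hle.not_gt (by positivity)
  · have hle := sub_nonpos.2 (hmax p hp s hs hpt hst)
    rw [heightAt_sub_heightAt hpq (hpt.trans hst), lineExcess_left, mul_zero, zero_add] at hle
    have := sub_pos.2 hpt
    have := sub_pos.2 hpq
    have := sub_pos.2 (hpt.trans hst)
    exact hle.not_gt (by positivity)

theorem UpperHullEdge.lineExcess_nonpos {S : Finset (ℝ × ℝ)} {p q s : ℝ × ℝ}
    (h : UpperHullEdge S p q) (hs : s ∈ S) : lineExcess p q s ≤ 0 := by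
  by_cases hsp : s = p
  · rw [hsp, lineExcess_left]
  by_cases hsq : s = q
  · rw [hsq, lineExcess_right]
  exact (strictlyBelow_iff_lineExcess_neg.1 (h.2.2.2 s hs hsp hsq)).le

theorem UpperHullEdge.heightAt_le {S : Finset (ℝ × ℝ)} {t : ℝ} {p q a b : ℝ × ℝ}
    (h : UpperHullEdge S p q) (ha : a ∈ S) (hb : b ∈ S) (hat : a.1 < t) (htb : t < b.1) :
    heightAt t a b ≤ heightAt t p q := by
  have hab := hat.trans htb
  rw [← sub_nonpos, heightAt_sub_heightAt h.2.2.1 hab]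
  exact div_nonpos_of_nonpos_of_nonneg
    (add_nonpos
      (mul_nonpos_of_nonneg_of_nonpos (sub_pos.2 htb).le (h.lineExcess_nonpos ha))
      (mul_nonpos_of_nonneg_of_nonpos (sub_pos.2 hat).le (h.lineExcess_nonpos hb)))
    (mul_pos (sub_pos.2 hab) (sub_pos.2 h.2.2.1)).le

/-- An upper-hull edge spanning `t` is the only pair on the two sides of `x = t` attaining
its height at `t`. -/
theorem UpperHullEdge.eq_of_heightAt_le {S : Finset (ℝ × ℝ)} {t : ℝ} {p q a b : ℝ × ℝ}
    (h : UpperHullEdge S p q) (hpt : p.1 < t) (htq : t < q.1)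
    (ha : a ∈ S) (hb : b ∈ S) (hat : a.1 < t) (htb : t < b.1)
    (hle : heightAt t p q ≤ heightAt t a b) : a = p ∧ b = q := by
  have hab := hat.trans htb
  have hsub := sub_nonneg.2 hle
  rw [heightAt_sub_heightAt h.2.2.1 hab,
    le_div_iff₀ (mul_pos (sub_pos.2 hab) (sub_pos.2 h.2.2.1)), zero_mul] at hsub
  have hA := mul_nonpos_of_nonneg_of_nonpos (sub_pos.2 htb).le (h.lineExcess_nonpos ha)
  have hB := mul_nonpos_of_nonneg_of_nonpos (sub_pos.2 hat).le (h.lineExcess_nonpos hb)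
  constructor
  · by_contra hne
    have haq : a ≠ q := by
      rintro rfl
      exact hat.not_gt htq
    have := mul_neg_of_pos_of_neg (sub_pos.2 htb)
      (strictlyBelow_iff_lineExcess_neg.1 (h.2.2.2 a ha hne haq))
    linarith
  · by_contra hne
    have hbp : b ≠ p := by
      rintro rfl
      exact htb.not_gt hpt
    have := mul_neg_of_pos_of_neg (sub_pos.2 hat)
      (strictlyBelow_iff_lineExcess_neg.1 (h.2.2.2 b hb hbp hne))
    linarith

theorem spanning_upper_hull_edge_exists_unique
    (P : Finset (ℝ × ℝ)) (hcard : 2 ≤ P.card) (hne : P.Nonempty)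
    (hgp : GeneralPosition P)
    (hx : ∀ p ∈ P, ∀ q ∈ P, p ≠ q → p.1 ≠ q.1)
    (t : ℝ)
    (hmin : P.inf' hne (fun p => p.1) < t)
    (hmax : t < P.sup' hne (fun p => p.1))
    (hdist : ∀ p ∈ P, p.1 ≠ t) :
    ∃! pq : (ℝ × ℝ) × (ℝ × ℝ),
      UpperHullEdge P pq.1 pq.2 ∧ pq.1.1 < t ∧ t < pq.2.1 := by
  obtain ⟨l, hl, hlt⟩ := (Finset.inf'_lt_iff hne).1 hmin
  obtain ⟨r, hr, htr⟩ := (Finset.lt_sup'_iff hne).1 hmax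
  let C := (P ×ˢ P).filter fun pq => pq.1.1 < t ∧ t < pq.2.1
  have hC : C.Nonempty := ⟨(l, r), by simp [C, hl, hr, hlt, htr]⟩
  obtain ⟨⟨p, q⟩, hpq, hpq_max⟩ := C.exists_max_image (fun pq => heightAt t pq.1 pq.2) hC
  obtain ⟨⟨hp, hq⟩, hpt, htq⟩ : (p ∈ P ∧ q ∈ P) ∧ p.1 < t ∧ t < q.1 := by
    simpa [C] using hpq
  have hedge : UpperHullEdge P p q :=
    upperHullEdge_of_heightAt_max hgp hdist hp hq hpt htq fun a ha b hb hat htb =>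
      hpq_max (a, b) (by simp [C, ha, hb, hat, htb])
  refine ⟨(p, q), ⟨hedge, hpt, htq⟩, ?_⟩
  rintro ⟨a, b⟩ ⟨hab, hat, htb⟩
  obtain ⟨hap, hbq⟩ := hedge.eq_of_heightAt_le hpt htq hab.1 hab.2.1 hat htb
    (hab.heightAt_le hp hq hpt htq)
  exact Prod.ext hap hbq
end
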